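/- (Variation of constants formula for the scalar fractional equation.) Let 0 < α < 1, λ ≥ 0, T > 0, u₀ ∈ ℝ, and let f : [0,T] → ℝ be continuously differentiable. Define u(t) = E_α(−λ t^α) u₀ + ∫₀ᵗ (t−r)^{α−1} E_{α,α}(−λ (t−r)^α) f(r) dr. Then u is continuous on [0,T], u(0) = u₀, and for every t ∈ (0,T] one has (D^α u)(t) + λ u(t) = f(t), where D^α is the Caputo fractional derivative of order α. -/

import Mathlib

open MeasureTheory Set

/-- The (real) Mittag-Leffler function `E_{α,β}(x) = Σ_{k} x^k / Γ(αk+β)`. -/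
noncomputable def mlE (α β x : ℝ) : ℝ :=
  ∑' k : ℕ, x ^ k / Real.Gamma (α * k + β)

/-- The Caputo fractional derivative of order `α`. -/
noncomputable def caputo (α : ℝ) (u : ℝ → ℝ) (t : ℝ) : ℝ :=
  (1 / Real.Gamma (1 - α)) * ∫ s in (0:ℝ)..t, deriv u s * (t - s) ^ (-α)

section Series

/-- A crude lower bound for the Gamma function, geometric of arbitrary ratio. -/
lemma rpow_mul_exp_neg_le_Gamma {s R : ℝ} (hs : 1 ≤ s) (hR : 0 < R) :
    R ^ (s - 1) * Real.exp (-R) ≤ Real.Gamma s := by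
  have hint := Real.GammaIntegral_convergent (lt_of_lt_of_le one_pos hs)
  rw [Real.Gamma_eq_integral (lt_of_lt_of_le one_pos hs), ← integral_exp_neg_Ioi R,
    ← integral_const_mul]
  have hsub : Ioi R ⊆ Ioi (0 : ℝ) := Ioi_subset_Ioi hR.le
  calc ∫ x in Ioi R, R ^ (s - 1) * Real.exp (-x)
      ≤ ∫ x in Ioi R, Real.exp (-x) * x ^ (s - 1) := by
        refine setIntegral_mono_on ((integrableOn_exp_neg_Ioi R).const_mul _)
          (hint.mono_set hsub) measurableSet_Ioi fun x hx => ?_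
        rw [mul_comm]
        gcongr
        exact le_of_lt hx
    _ ≤ ∫ x in Ioi (0 : ℝ), Real.exp (-x) * x ^ (s - 1) := by
        refine setIntegral_mono_set hint ?_ hsub.eventuallyLE
        filter_upwards [ae_restrict_mem measurableSet_Ioi] with x hx
        exact mul_nonneg (Real.exp_pos _).le (Real.rpow_nonneg (le_of_lt hx) _)

lemma summable_pow_div_Gamma {α β : ℝ} (hα : 0 < α) (x : ℝ) :
    Summable fun k : ℕ => x ^ k / Real.Gamma (α * k + β) := by
  set M : ℝ := 2 * |x| + 1 with hM
  have hM0 : 0 < M := by positivity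
  set R : ℝ := M ^ (α⁻¹) with hR
  have hR0 : 0 < R := Real.rpow_pos_of_pos hM0 _
  have hq : |x| / M < 1 := by
    rw [div_lt_one hM0]; have := abs_nonneg x; linarith
  refine ((summable_geometric_of_lt_one (by positivity) hq).mul_left
    (R ^ (1 - β) * Real.exp R)).of_norm_bounded_eventually_nat ?_
  obtain ⟨N, hN⟩ := exists_nat_gt ((1 - β) / α)
  filter_upwards [Filter.eventually_ge_atTop N] with k hk
  have hk1 : 1 ≤ α * k + β := by
    have : (1 - β) / α < k := hN.trans_le (by exact_mod_cast hk)
    rw [div_lt_iff₀ hα] at this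
    linarith
  have hG := rpow_mul_exp_neg_le_Gamma hk1 hR0
  have hRk : R ^ (α * k + β - 1) = M ^ k * (R ^ (1 - β))⁻¹ := by
    rw [show α * k + β - 1 = α * k + -(1 - β) by ring, Real.rpow_add hR0, Real.rpow_neg hR0.le,
      hR, ← Real.rpow_mul hM0.le, ← mul_assoc, inv_mul_cancel₀ hα.ne', one_mul, Real.rpow_natCast]
  have hp : 0 < R ^ (1 - β) := Real.rpow_pos_of_pos hR0 _
  rw [hRk, Real.exp_neg] at hG
  rw [norm_div, norm_pow, Real.norm_eq_abs, Real.norm_eq_abs,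
    abs_of_pos (Real.Gamma_pos_of_pos (lt_of_lt_of_le one_pos hk1))]
  refine (div_le_div_of_nonneg_left (by positivity) (by positivity) hG).trans (le_of_eq ?_)
  rw [div_pow]
  field_simp

lemma continuous_mlE {α β : ℝ} (hα : 0 < α) : Continuous (mlE α β) := by
  rw [continuous_iff_continuousAt]
  intro x
  have hx : x ∈ Metric.ball (0 : ℝ) (|x| + 1) := by simp
  refine ContinuousOn.continuousAt (s := Metric.ball 0 (|x| + 1)) ?_
    (Metric.isOpen_ball.mem_nhds hx)
  refine continuousOn_tsum (fun k => by fun_prop)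
    (summable_pow_div_Gamma (β := β) hα (|x| + 1)).norm fun k y hy => ?_
  rw [norm_div, norm_div, norm_pow, norm_pow]
  have h1 : ‖y‖ ≤ ‖|x| + 1‖ := by
    rw [Real.norm_eq_abs (|x| + 1), abs_of_nonneg (by positivity)]
    simpa using (mem_ball_zero_iff.1 hy).le
  gcongr

lemma mlE_one_eq {α : ℝ} (hα : 0 < α) (z : ℝ) : mlE α 1 z = 1 + z * mlE α (α + 1) z := by
  unfold mlE
  rw [(summable_pow_div_Gamma hα z).tsum_eq_zero_add, ← tsum_mul_left]
  congr 1
  · simp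
  · refine tsum_congr fun k => ?_
    rw [show α * ((k + 1 : ℕ) : ℝ) + 1 = α * k + (α + 1) by push_cast; ring]
    ring

lemma integral_rpow_mul_sub_rpow {a b t : ℝ} (ha : 0 < a) (hb : 0 < b) (ht : 0 < t) :
    ∫ s in (0 : ℝ)..t, s ^ (a - 1) * (t - s) ^ (b - 1) =
      t ^ (a + b - 1) * (Real.Gamma a * Real.Gamma b / Real.Gamma (a + b)) := by
  have h := Complex.betaIntegral_scaled a b ht
  rw [Complex.betaIntegral_eq_Gamma_mul_div _ _ (by simpa) (by simpa)] at h
  apply Complex.ofReal_injective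
  rw [← intervalIntegral.integral_ofReal]
  push_cast
  rw [Complex.ofReal_cpow ht.le, ← Complex.Gamma_ofReal, ← Complex.Gamma_ofReal,
    ← Complex.Gamma_ofReal]
  push_cast
  rw [← h]
  refine intervalIntegral.integral_congr fun s hs => ?_
  rw [uIcc_of_le ht.le] at hs
  rw [Complex.ofReal_cpow hs.1, Complex.ofReal_cpow (sub_nonneg.2 hs.2)]
  push_cast
  rfl

lemma intervalIntegrable_rpow_mul_sub_rpow {a b t : ℝ} (ha : 0 < a) (hb : 0 < b) (ht : 0 < t) :
    IntervalIntegrable (fun s => s ^ (a - 1) * (t - s) ^ (b - 1)) volume 0 t := by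
  by_contra h
  have h0 := intervalIntegral.integral_undef h
  rw [integral_rpow_mul_sub_rpow ha hb ht] at h0
  have := Real.Gamma_pos_of_pos ha
  have := Real.Gamma_pos_of_pos hb
  have := Real.Gamma_pos_of_pos (add_pos ha hb)
  have := Real.rpow_pos_of_pos ht (a + b - 1)
  exact absurd h0 (by positivity)

/-- The kernel `t ^ (β - 1) E_{α,β}(-λ t ^ α)`. -/
noncomputable def mlKernel (α β lam t : ℝ) : ℝ := t ^ (β - 1) * mlE α β (-lam * t ^ α)

lemma mlKernel_eq_tsum {α β lam t : ℝ} (ht : 0 < t) :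
    mlKernel α β lam t =
      ∑' k : ℕ, (-lam) ^ k / Real.Gamma (α * k + β) * t ^ (α * k + β - 1) := by
  rw [mlKernel, mlE, ← tsum_mul_left]
  refine tsum_congr fun k => ?_
  rw [show α * k + β - 1 = α * k + (β - 1) by ring, Real.rpow_add ht, mul_pow,
    Real.rpow_mul ht.le, Real.rpow_natCast]
  ring

lemma continuous_mlE_comp_rpow {α β lam : ℝ} (hα : 0 < α) :
    Continuous fun s : ℝ => mlE α β (-lam * s ^ α) :=
  (continuous_mlE hα).comp (continuous_const.mul (Real.continuous_rpow_const hα.le))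

lemma intervalIntegrable_mlKernel {α β lam : ℝ} (hα : 0 < α) (hβ : 0 < β) (a b : ℝ) :
    IntervalIntegrable (mlKernel α β lam) volume a b :=
  (intervalIntegral.intervalIntegrable_rpow' (by linarith)).mul_continuousOn
    (continuous_mlE_comp_rpow hα).continuousOn

lemma intervalIntegrable_mlKernel_mul_sub_rpow {α β γ lam t : ℝ} (hα : 0 < α) (hβ : 0 < β)
    (hγ : 0 < γ) (ht : 0 < t) :
    IntervalIntegrable (fun s => mlKernel α β lam s * ((t - s) ^ (γ - 1) / Real.Gamma γ))
      volume 0 t := by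
  have h := ((intervalIntegrable_rpow_mul_sub_rpow hβ hγ ht).mul_continuousOn
    (continuous_mlE_comp_rpow (β := β) (lam := lam) hα).continuousOn).div_const (Real.Gamma γ)
  refine h.congr (fun s _ => ?_)
  simp only [mlKernel]
  ring

/-- Fractional integration raises the second index of the Mittag-Leffler kernel. -/
lemma integral_mlKernel_mul_sub_rpow {α β γ lam t : ℝ} (hα : 0 < α) (hβ : 0 < β)
    (hγ : 0 < γ) (ht : 0 < t) :
    ∫ s in (0 : ℝ)..t, mlKernel α β lam s * ((t - s) ^ (γ - 1) / Real.Gamma γ) =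
      mlKernel α (β + γ) lam t := by
  have hpos : ∀ k : ℕ, 0 < α * k + β := fun k => by positivity
  have hΓγ := Real.Gamma_pos_of_pos hγ
  have hΓ : ∀ k : ℕ, 0 < Real.Gamma (α * k + β) := fun k => Real.Gamma_pos_of_pos (hpos k)
  have hΓ' : ∀ k : ℕ, 0 < Real.Gamma (α * k + (β + γ)) := fun k =>
    Real.Gamma_pos_of_pos (by positivity)
  have hterm : ∀ (l : ℝ) (k : ℕ), ∫ s in Ioc 0 t, l ^ k / Real.Gamma (α * k + β) / Real.Gamma γ *
      (s ^ (α * k + β - 1) * (t - s) ^ (γ - 1)) =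
      l ^ k / Real.Gamma (α * k + (β + γ)) * t ^ (α * k + (β + γ) - 1) := by
    intro l k
    rw [integral_const_mul, ← intervalIntegral.integral_of_le ht.le,
      integral_rpow_mul_sub_rpow (hpos k) hγ ht, add_assoc]
    have := (hΓ k).ne'
    have := (hΓ' k).ne'
    field_simp
  have hsum := hasSum_integral_of_summable_integral_norm (μ := volume.restrict (Ioc 0 t))
    (F := fun (k : ℕ) s => (-lam) ^ k / Real.Gamma (α * k + β) / Real.Gamma γ *
      (s ^ (α * k + β - 1) * (t - s) ^ (γ - 1)))
    (fun k => ((intervalIntegrable_iff_integrableOn_Ioc_of_le ht.le).1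
      (intervalIntegrable_rpow_mul_sub_rpow (hpos k) hγ ht)).const_mul _) ?_
  · rw [mlKernel_eq_tsum ht, intervalIntegral.integral_of_le ht.le]
    simp_rw [hterm] at hsum
    rw [hsum.tsum_eq]
    refine setIntegral_congr_fun measurableSet_Ioc fun s hs => ?_
    rw [mlKernel_eq_tsum hs.1, ← tsum_mul_right]
    exact tsum_congr fun k => by ring
  · have hn : ∀ k : ℕ, (∫ s in Ioc 0 t, ‖(-lam) ^ k / Real.Gamma (α * k + β) / Real.Gamma γ *
        (s ^ (α * k + β - 1) * (t - s) ^ (γ - 1))‖) =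
        t ^ (β + γ - 1) * ((|lam| * t ^ α) ^ k / Real.Gamma (α * k + (β + γ))) := by
      intro k
      have := hterm |lam| k
      rw [show α * k + (β + γ) - 1 = α * k + (β + γ - 1) by ring, Real.rpow_add ht,
        Real.rpow_mul ht.le, Real.rpow_natCast] at this
      rw [mul_pow, show t ^ (β + γ - 1) * (|lam| ^ k * (t ^ α) ^ k / Real.Gamma (α * k + (β + γ)))
        = |lam| ^ k / Real.Gamma (α * k + (β + γ)) * ((t ^ α) ^ k * t ^ (β + γ - 1)) by ring,
        ← this]
      refine setIntegral_congr_fun measurableSet_Ioc fun s hs => ?_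
      rw [norm_mul, norm_div, norm_div, norm_pow, norm_neg, Real.norm_eq_abs lam,
        Real.norm_of_nonneg (hΓ k).le, Real.norm_of_nonneg hΓγ.le, Real.norm_of_nonneg]
      exact mul_nonneg (Real.rpow_nonneg hs.1.le _) (Real.rpow_nonneg (sub_nonneg.2 hs.2) _)
    simp_rw [hn]
    exact (summable_pow_div_Gamma hα _).mul_left _

end Series

section Convolution

open scoped Convolution
open ContinuousLinearMap (mul)

lemma indicator_convolution_integrand {F G a b : ℝ → ℝ} {t : ℝ}
    (hF0 : ∀ x ≤ 0, F x = 0) (hG0 : ∀ x ≤ 0, G x = 0)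
    (hF : ∀ x ∈ Ioo 0 t, F x = a x) (hG : ∀ x ∈ Ioo 0 t, G x = b x) :
    (fun r => F r * G (t - r)) = (Ioo 0 t).indicator fun r => a r * b (t - r) := by
  ext r
  by_cases hr : r ∈ Ioo 0 t
  · rw [indicator_of_mem hr, hF r hr, hG _ ⟨by linarith [hr.2], by linarith [hr.1]⟩]
  · rw [indicator_of_notMem hr]
    rcases le_or_gt r 0 with h | h
    · rw [hF0 r h, zero_mul]
    · rw [hG0 (t - r) (by by_contra hc; exact hr ⟨h, by linarith⟩), mul_zero]

/-- The convolution of functions vanishing on `(-∞, 0]` is an integral over `[0, t]`. -/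
lemma convolution_eq_intervalIntegral {F G a b : ℝ → ℝ} {t : ℝ} (ht : 0 ≤ t)
    (hF0 : ∀ x ≤ 0, F x = 0) (hG0 : ∀ x ≤ 0, G x = 0)
    (hF : ∀ x ∈ Ioo 0 t, F x = a x) (hG : ∀ x ∈ Ioo 0 t, G x = b x) :
    (F ⋆[mul ℝ ℝ] G) t = ∫ r in (0 : ℝ)..t, a r * b (t - r) := by
  rw [convolution_def, intervalIntegral.integral_of_le ht, integral_Ioc_eq_integral_Ioo,
    ← integral_indicator measurableSet_Ioo, ← indicator_convolution_integrand hF0 hG0 hF hG]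
  rfl

lemma convolutionExistsAt_of_intervalIntegrable {F G a b : ℝ → ℝ} {t : ℝ} (ht : 0 ≤ t)
    (hF0 : ∀ x ≤ 0, F x = 0) (hG0 : ∀ x ≤ 0, G x = 0)
    (hF : ∀ x ∈ Ioo 0 t, F x = a x) (hG : ∀ x ∈ Ioo 0 t, G x = b x)
    (h : IntervalIntegrable (fun r => a r * b (t - r)) volume 0 t) :
    ConvolutionExistsAt F G t (mul ℝ ℝ) := by
  change Integrable (fun r => F r * G (t - r))
  rw [indicator_convolution_integrand hF0 hG0 hF hG, integrable_indicator_iff measurableSet_Ioo]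
  exact ((intervalIntegrable_iff_integrableOn_Ioc_of_le ht).1 h).mono_set Ioo_subset_Ioc_self

lemma convolution_eq_zero_of_nonpos {F G : ℝ → ℝ} (hF0 : ∀ x ≤ 0, F x = 0)
    (hG0 : ∀ x ≤ 0, G x = 0) (x : ℝ) (hx : x ≤ 0) : (F ⋆[mul ℝ ℝ] G) x = 0 := by
  rw [convolution_def]
  refine integral_eq_zero_of_ae (Filter.Eventually.of_forall fun r => ?_)
  rcases le_or_gt r 0 with h | h
  · simp [hF0 r h]
  · simp [hG0 (x - r) (by linarith)]

lemma convolutionExistsAt_of_bound {F H : ℝ → ℝ} {C : ℝ} (hF : Integrable F)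
    (hH : AEStronglyMeasurable H) (hC : ∀ x, |H x| ≤ C) (t : ℝ) :
    ConvolutionExistsAt F H t (mul ℝ ℝ) :=
  hF.mul_bdd (g := fun r => H (t - r)) (c := C)
    (hH.comp_measurePreserving (Measure.measurePreserving_sub_left volume t))
    (Filter.Eventually.of_forall fun _ => hC _)

lemma abs_convolution_le {F H : ℝ → ℝ} {C : ℝ} (hF : Integrable F)
    (hH : AEStronglyMeasurable H) (hC : ∀ x, |H x| ≤ C) (t : ℝ) :
    |(F ⋆[mul ℝ ℝ] H) t| ≤ (∫ r, |F r|) * C := by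
  rw [convolution_def, ← integral_mul_const]
  refine (abs_integral_le_integral_abs).trans ?_
  refine integral_mono (convolutionExistsAt_of_bound hF hH hC t).abs (hF.abs.mul_const C)
    fun r => ?_
  simp only [ContinuousLinearMap.mul_apply', abs_mul]
  exact mul_le_mul_of_nonneg_left (hC _) (abs_nonneg _)

lemma convolution_assoc_of_bound {F G H : ℝ → ℝ} {C : ℝ} (hF : Integrable F) (hG : Integrable G)
    (hH : Integrable H) (hC : ∀ x, |H x| ≤ C) (t : ℝ) :
    ((F ⋆[mul ℝ ℝ] G) ⋆[mul ℝ ℝ] H) t = (F ⋆[mul ℝ ℝ] (G ⋆[mul ℝ ℝ] H)) t := by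
  have hC' : ∀ x, |‖H x‖| ≤ C := fun x => by simpa using hC x
  refine convolution_assoc (mul ℝ ℝ) (mul ℝ ℝ) (mul ℝ ℝ) (mul ℝ ℝ)
    (fun x y z => by simp [mul_assoc]) hF.1 hG.1 hH.1 (hF.ae_convolution_exists _ hG)
    (hG.norm.ae_convolution_exists _ hH.norm) ?_
  exact convolutionExistsAt_of_bound hF.norm (hG.norm.integrable_convolution _ hH.norm).1
    (abs_convolution_le hG.norm hH.norm.1 hC') t

lemma convolution_mul_comm (F G : ℝ → ℝ) : (F ⋆[mul ℝ ℝ] G) = (G ⋆[mul ℝ ℝ] F) := by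
  rw [← convolution_flip]
  congr 1
  ext
  simp

end Convolution

section Cutoff

open scoped Convolution
open ContinuousLinearMap (mul)

lemma indicator_Ioc_eq_zero (T : ℝ) (a : ℝ → ℝ) (x : ℝ) (hx : x ≤ 0) :
    (Ioc 0 T).indicator a x = 0 :=
  indicator_of_notMem (fun h => absurd h.1 hx.not_gt) a

lemma indicator_Ioc_eq_self {t T : ℝ} (htT : t ≤ T) (a : ℝ → ℝ) (x : ℝ) (hx : x ∈ Ioo 0 t) :
    (Ioc 0 T).indicator a x = a x :=
  indicator_of_mem (show x ∈ Ioc 0 T from ⟨hx.1, hx.2.le.trans htT⟩) a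

lemma integrable_indicator_Ioc {T : ℝ} (hT : 0 ≤ T) {a : ℝ → ℝ}
    (ha : IntervalIntegrable a volume 0 T) : Integrable ((Ioc 0 T).indicator a) :=
  (integrable_indicator_iff measurableSet_Ioc).2
    ((intervalIntegrable_iff_integrableOn_Ioc_of_le hT).1 ha)

lemma convolution_indicator_Ioc {a b : ℝ → ℝ} {t T : ℝ} (ht : 0 ≤ t) (htT : t ≤ T) :
    ((Ioc 0 T).indicator a ⋆[mul ℝ ℝ] (Ioc 0 T).indicator b) t =
      ∫ r in (0 : ℝ)..t, a r * b (t - r) :=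
  convolution_eq_intervalIntegral ht (indicator_Ioc_eq_zero T a) (indicator_Ioc_eq_zero T b)
    (indicator_Ioc_eq_self htT a) (indicator_Ioc_eq_self htT b)

lemma convolution_indicator_one_eq {w : ℝ → ℝ} {t T : ℝ} (ht : 0 ≤ t) (htT : t ≤ T)
    (hw : ∀ x ≤ 0, w x = 0) :
    ((Ioc 0 T).indicator (fun _ => (1 : ℝ)) ⋆[mul ℝ ℝ] w) t = ∫ r in (0 : ℝ)..t, w r := by
  rw [convolution_mul_comm, convolution_eq_intervalIntegral ht hw (indicator_Ioc_eq_zero T _)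
    (fun _ _ => rfl) (indicator_Ioc_eq_self htT _)]
  simp

end Cutoff

lemma mlKernel_one (α lam t : ℝ) : mlKernel α 1 lam t = mlE α 1 (-lam * t ^ α) := by
  simp [mlKernel]

lemma mlKernel_one_eq {α : ℝ} (hα : 0 < α) (lam t : ℝ) :
    mlKernel α 1 lam t = 1 - lam * mlKernel α (α + 1) lam t := by
  rw [mlKernel_one, mlE_one_eq hα, mlKernel, add_sub_cancel_right]
  ring

lemma integral_mlKernel {α β lam t : ℝ} (hα : 0 < α) (hβ : 0 < β) (ht : 0 < t) :
    ∫ s in (0 : ℝ)..t, mlKernel α β lam s = mlKernel α (β + 1) lam t := by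
  rw [← integral_mlKernel_mul_sub_rpow hα hβ one_pos ht]
  simp

lemma intervalIntegral_comp_sub_mul (a b : ℝ → ℝ) (t : ℝ) :
    ∫ r in (0 : ℝ)..t, a (t - r) * b r = ∫ r in (0 : ℝ)..t, a r * b (t - r) := by
  have := intervalIntegral.integral_comp_sub_left (fun r => a r * b (t - r)) (a := 0) (b := t) t
  simpa using this

open scoped Convolution in
open ContinuousLinearMap (mul) in
/-- Variation of constants: `u(t) = E_α(−λt^α) u₀ +
∫₀ᵗ (t−r)^{α−1} E_{α,α}(−λ(t−r)^α) f(r) dr` is continuous on `[0,T]`,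
satisfies `u(0) = u₀`, and solves `D^α u + λ u = f` on `(0,T]`. -/
theorem variation_of_constants
    (α lam T u₀ : ℝ) (hα : 0 < α) (hα1 : α < 1) (hlam : 0 ≤ lam) (hT : 0 < T)
    (f f' : ℝ → ℝ)
    (hf : ∀ s ∈ Icc (0:ℝ) T, HasDerivWithinAt f (f' s) (Icc 0 T) s)
    (hf' : ContinuousOn f' (Icc 0 T))
    (u : ℝ → ℝ)
    (hu : ∀ t : ℝ, u t = mlE α 1 (-lam * t ^ α) * u₀
        + ∫ r in (0:ℝ)..t, (t - r) ^ (α - 1) * mlE α α (-lam * (t - r) ^ α) * f r) :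
    ContinuousOn u (Icc 0 T) ∧ u 0 = u₀ ∧
      ∀ t ∈ Ioc (0:ℝ) T, caputo α u t + lam * u t = f t := by
  set e : ℝ → ℝ := mlKernel α α lam with he
  set K : ℝ → ℝ := fun s => s ^ ((1 - α) - 1) / Real.Gamma (1 - α) with hK
  have hβ : 0 < 1 - α := by linarith
  set eT := (Ioc 0 T).indicator e with heT
  set oT := (Ioc 0 T).indicator (fun _ => (1 : ℝ)) with hoT
  set KT := (Ioc 0 T).indicator K with hKT
  set fT := (Ioc 0 T).indicator f' with hfT
  have eT0 : ∀ x ≤ 0, eT x = 0 := indicator_Ioc_eq_zero T e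
  have oT0 : ∀ x ≤ 0, oT x = 0 := indicator_Ioc_eq_zero T _
  have KT0 : ∀ x ≤ 0, KT x = 0 := indicator_Ioc_eq_zero T K
  have fT0 : ∀ x ≤ 0, fT x = 0 := indicator_Ioc_eq_zero T f'
  have eI : Integrable eT :=
    integrable_indicator_Ioc hT.le (intervalIntegrable_mlKernel hα hα 0 T)
  have oI : Integrable oT := integrable_indicator_Ioc hT.le intervalIntegrable_const
  have KI : Integrable KT := integrable_indicator_Ioc hT.le
    ((intervalIntegral.intervalIntegrable_rpow' (by linarith)).div_const _)
  have f'I : IntervalIntegrable f' volume 0 T :=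
    ContinuousOn.intervalIntegrable (by rwa [uIcc_of_le hT.le])
  have fI : Integrable fT := integrable_indicator_Ioc hT.le f'I
  obtain ⟨C, hC⟩ : ∃ C, ∀ x, |fT x| ≤ C := by
    obtain ⟨C, hC⟩ := isCompact_Icc.exists_bound_of_continuousOn hf'
    refine ⟨C, fun x => ?_⟩
    by_cases hx : x ∈ Ioc 0 T
    · rw [hfT, indicator_of_mem hx]; exact hC x (Ioc_subset_Icc_self hx)
    · rw [hfT, indicator_of_notMem hx, abs_zero]
      exact (norm_nonneg _).trans (hC 0 (left_mem_Icc.2 hT.le))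
  set w := eT ⋆[mul ℝ ℝ] fT with hw
  have w0 : ∀ x ≤ 0, w x = 0 := convolution_eq_zero_of_nonpos eT0 fT0
  have wI : Integrable w := eI.integrable_convolution _ fI
  have hftc : ∀ t ∈ Icc 0 T, ∫ s in (0 : ℝ)..t, f' s = f t - f 0 := by
    intro t ht
    refine intervalIntegral.integral_eq_sub_of_hasDerivAt_of_le ht.1
      (fun s hs => ((hf s ⟨hs.1, hs.2.trans ht.2⟩).continuousWithinAt).mono
        (Icc_subset_Icc_right ht.2))
      (fun s hs => (hf s ⟨hs.1.le, hs.2.le.trans ht.2⟩).hasDerivAt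
        (Icc_mem_nhds hs.1 (hs.2.trans_le ht.2)))
      (f'I.mono_set ?_)
    rw [uIcc_of_le hT.le, uIcc_of_le ht.1]
    exact Icc_subset_Icc_right ht.2
  have hof : ∀ t ∈ Icc 0 T, (oT ⋆[mul ℝ ℝ] fT) t = f t - f 0 := by
    intro t ht
    rw [hoT, convolution_indicator_one_eq ht.1 ht.2 fT0, ← hftc t ht]
    refine intervalIntegral.integral_congr_ae (Filter.Eventually.of_forall fun s hs => ?_)
    rw [uIoc_of_le ht.1] at hs
    exact indicator_of_mem (show s ∈ Ioc 0 T from ⟨hs.1, hs.2.trans ht.2⟩) f'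
  have how : oT ⋆[mul ℝ ℝ] w = eT ⋆[mul ℝ ℝ] (oT ⋆[mul ℝ ℝ] fT) := by
    ext x
    rw [hw, ← convolution_assoc_of_bound oI eI fI hC, ← convolution_assoc_of_bound eI oI fI hC,
      convolution_mul_comm oT eT]
  set c := f 0 - lam * u₀ with hc
  set g : ℝ → ℝ := fun s => c * eT s + w s with hg
  have gI : Integrable g := (eI.const_mul c).add wI
  have hG : ∀ t ∈ Ioc 0 T, ∫ s in (0 : ℝ)..t, g s =
      c * mlKernel α (α + 1) lam t + (oT ⋆[mul ℝ ℝ] w) t := by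
    intro t ht
    rw [hg, intervalIntegral.integral_add (eI.const_mul c).intervalIntegrable
      wI.intervalIntegrable, hoT, convolution_indicator_one_eq ht.1.le ht.2 w0,
      intervalIntegral.integral_const_mul, ← integral_mlKernel hα hα ht.1]
    congr 2
    refine intervalIntegral.integral_congr_ae (Filter.Eventually.of_forall fun s hs => ?_)
    rw [uIoc_of_le ht.1.le] at hs
    exact indicator_of_mem (show s ∈ Ioc 0 T from ⟨hs.1, hs.2.trans ht.2⟩) e
  have hu0 : u 0 = u₀ := by
    rw [hu, Real.zero_rpow hα.ne', mul_zero, mlE_one_eq hα]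
    simp
  have hug : ∀ t ∈ Icc 0 T, u t = u₀ + ∫ s in (0 : ℝ)..t, g s := by
    intro t ht
    rcases ht.1.eq_or_lt with rfl | ht0
    · simp [hu0]
    have heI : IntervalIntegrable e volume 0 t := intervalIntegrable_mlKernel hα hα 0 t
    have hE : ∫ r in (0:ℝ)..t, e r * (oT ⋆[mul ℝ ℝ] fT) (t - r) =
        (eT ⋆[mul ℝ ℝ] (oT ⋆[mul ℝ ℝ] fT)) t :=
      (convolution_eq_intervalIntegral ht.1 eT0 (convolution_eq_zero_of_nonpos oT0 fT0)
        (indicator_Ioc_eq_self ht.2 e) fun _ _ => rfl).symm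
    have hfc : ContinuousOn (fun r => f (t - r)) (uIcc 0 t) := by
      have hfcont : ContinuousOn f (Icc 0 T) := fun s hs => (hf s hs).continuousWithinAt
      refine hfcont.comp (by fun_prop) fun r hr => ?_
      rw [uIcc_of_le ht.1] at hr
      exact ⟨by linarith [hr.2], by linarith [hr.1, ht.2]⟩
    have hsplit : ∫ r in (0:ℝ)..t, e r * f (t - r) =
        f 0 * mlKernel α (α + 1) lam t + (eT ⋆[mul ℝ ℝ] (oT ⋆[mul ℝ ℝ] fT)) t := by
      rw [← hE, ← integral_mlKernel hα hα ht0, ← intervalIntegral.integral_const_mul,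
        ← sub_eq_iff_eq_add', ← intervalIntegral.integral_sub (heI.mul_continuousOn hfc)
          (heI.const_mul _)]
      refine intervalIntegral.integral_congr fun r hr => ?_
      rw [uIcc_of_le ht.1] at hr
      rw [hof (t - r) ⟨by linarith [hr.2], by linarith [hr.1, ht.2]⟩]
      ring
    have hr := intervalIntegral_comp_sub_mul e f t
    rw [hsplit] at hr
    rw [hu, hG t ⟨ht0, ht.2⟩, ← mlKernel_one, mlKernel_one_eq hα, how]
    simp only [he, mlKernel] at hr ⊢
    rw [hr, hc]
    ring
  refine ⟨?_, hu0, fun t ht => ?_⟩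
  · refine ContinuousOn.congr (f := fun t => u₀ + ∫ s in (0 : ℝ)..t, g s) ?_ hug
    exact (continuous_const.add
      (intervalIntegral.continuous_primitive (fun _ _ => gI.intervalIntegrable) 0)).continuousOn
  have htT : t ∈ Icc 0 T := ⟨ht.1.le, ht.2⟩
  have hcap : caputo α u t = (g ⋆[mul ℝ ℝ] KT) t := by
    have g0 : ∀ x ≤ 0, g x = 0 := fun x hx => by simp [hg, eT0 x hx, w0 x hx]
    rw [convolution_eq_intervalIntegral ht.1.le g0 KT0 (fun _ _ => rfl)
      (indicator_Ioc_eq_self ht.2 K), caputo, ← intervalIntegral.integral_const_mul]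
    refine intervalIntegral.integral_congr_ae ?_
    have hne : ∀ᵐ s : ℝ, s ≠ T := by simp [ae_iff]
    filter_upwards [(gI.intervalIntegrable (a := 0) (b := T)).ae_hasDerivAt_integral, hne]
      with s hs hsT hst
    rw [uIoc_of_le ht.1.le] at hst
    rw [uIcc_of_le hT.le] at hs
    have hs' : s ∈ Ioo 0 T := ⟨hst.1, lt_of_le_of_ne (hst.2.trans ht.2) hsT⟩
    have hd := (hs (Ioo_subset_Icc_self hs') 0 (left_mem_Icc.2 hT.le)).const_add u₀
    have hdu : HasDerivAt u (g s) s := hd.congr_of_eventuallyEq <| by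
      filter_upwards [Icc_mem_nhds hs'.1 hs'.2] with x hx using hug x hx
    rw [hdu.deriv, hK, show (1 - α) - 1 = -α by ring]
    ring
  have hKe : ∀ x ∈ Ioc 0 T, (eT ⋆[mul ℝ ℝ] KT) x = mlKernel α 1 lam x := by
    intro x hx
    rw [heT, hKT, convolution_indicator_Ioc hx.1.le hx.2, hK, he,
      integral_mlKernel_mul_sub_rpow hα hα hβ hx.1, add_sub_cancel]
  have hoe : ∀ x ∈ Ioc 0 T, (oT ⋆[mul ℝ ℝ] eT) x = mlKernel α (α + 1) lam x := by
    intro x hx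
    rw [convolution_mul_comm, heT, hoT, convolution_indicator_Ioc hx.1.le hx.2, he,
      ← integral_mlKernel hα hα hx.1]
    simp
  have hexe : ConvolutionExistsAt eT KT t (mul ℝ ℝ) :=
    convolutionExistsAt_of_intervalIntegrable ht.1.le eT0 KT0 (indicator_Ioc_eq_self ht.2 e)
      (indicator_Ioc_eq_self ht.2 K) (intervalIntegrable_mlKernel_mul_sub_rpow hα hα hβ ht.1)
  have hexw : ConvolutionExistsAt w KT t (mul ℝ ℝ) := by
    have := (convolutionExistsAt_of_bound KI wI.1 (abs_convolution_le eI fI.1 hC) t).integrable_swap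
    refine this.congr (Filter.Eventually.of_forall fun x => ?_)
    simp [mul_comm]
  have hlin : (g ⋆[mul ℝ ℝ] KT) t =
      c * (eT ⋆[mul ℝ ℝ] KT) t + (w ⋆[mul ℝ ℝ] KT) t := by
    simp only [convolution_def, ← integral_const_mul]
    rw [← integral_add (Integrable.const_mul hexe c) hexw]
    refine integral_congr_ae (Filter.Eventually.of_forall fun x => ?_)
    simp only [ContinuousLinearMap.mul_apply', hg]
    ring
  have hwK : (w ⋆[mul ℝ ℝ] KT) t = ∫ r in (0 : ℝ)..t, mlKernel α 1 lam r * f' (t - r) := by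
    rw [convolution_mul_comm, hw, ← convolution_assoc_of_bound KI eI fI hC,
      convolution_mul_comm KT eT]
    exact convolution_eq_intervalIntegral ht.1.le (convolution_eq_zero_of_nonpos eT0 KT0) fT0
      (fun x hx => hKe x ⟨hx.1, hx.2.le.trans ht.2⟩) (indicator_Ioc_eq_self ht.2 f')
  have hwo : (oT ⋆[mul ℝ ℝ] w) t =
      ∫ r in (0 : ℝ)..t, mlKernel α (α + 1) lam r * f' (t - r) := by
    rw [hw, ← convolution_assoc_of_bound oI eI fI hC]
    exact convolution_eq_intervalIntegral ht.1.le (convolution_eq_zero_of_nonpos oT0 eT0) fT0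
      (fun x hx => hoe x ⟨hx.1, hx.2.le.trans ht.2⟩) (indicator_Ioc_eq_self ht.2 f')
  have hrel : (w ⋆[mul ℝ ℝ] KT) t = f t - f 0 - lam * (oT ⋆[mul ℝ ℝ] w) t := by
    have hfc : ContinuousOn (fun r => f' (t - r)) (uIcc 0 t) := by
      refine hf'.comp (by fun_prop) fun r hr => ?_
      rw [uIcc_of_le ht.1.le] at hr
      exact ⟨by linarith [hr.2], by linarith [hr.1, ht.2]⟩
    have hrev : ∫ r in (0 : ℝ)..t, f' (t - r) = f t - f 0 := by
      rw [← hftc t htT]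
      simp
    rw [hwK, hwo, ← hrev, ← intervalIntegral.integral_const_mul,
      ← intervalIntegral.integral_sub hfc.intervalIntegrable
        (((intervalIntegrable_mlKernel hα (by linarith) 0 t).mul_continuousOn hfc).const_mul lam)]
    refine intervalIntegral.integral_congr fun r _ => ?_
    simp only [mlKernel_one_eq hα]
    ring
  rw [hcap, hlin, hKe t ht, hrel, hug t htT, hG t ht, mlKernel_one_eq hα, hc]
  ring
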